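/- Let m ≥ 2 and H = {x ∈ ℝ^m : x_m ≥ 0} the closed upper halfspace. Let Q : [0,∞) → (0,∞) be nondecreasing with Q(t) = o(t²) as t → +∞ and liminf_{t→+∞} Q(t)·log t / t² < +∞. Let a and b be continuous functions on H, write a = a₊ − a₋ with a₊, a₋ the positive and negative parts of a, and assume: sup_H a₋ < +∞; b(x) > 0 on H with b(x) ≥ 1/Q(|x|) outside a compact subset of H; and a₋(x)/b(x) ≤ H₀ on H for some constant H₀ > 0. Let σ > 1 and let u ≥ 0 be C² on an open neighborhood of H with ∂u/∂x_m(x) ≥ 0 at every boundary point x (with x_m = 0), satisfying Δu ≥ b(x)·u^σ + a(x)·u on Ω_γ = {x ∈ H : u(x) > γ} for some γ ∈ ℝ with γ < sup_H u ≤ +∞. Then u(x) ≤ H₀^{1/(σ−1)} for every x ∈ Ω_γ. -/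

import Mathlib

open Filter

/-- The partial derivative of `f : ℝ^m → ℝ` in the `i`-th coordinate direction. -/
noncomputable def pderivE {m : ℕ} (i : Fin m) (f : EuclideanSpace ℝ (Fin m) → ℝ)
    (x : EuclideanSpace ℝ (Fin m)) : ℝ :=
  fderiv ℝ f x (EuclideanSpace.single i 1)

/-- The Euclidean Laplacian of `f : ℝ^m → ℝ`, i.e. the sum of the pure second partial
derivatives. -/
noncomputable def laplacianE {m : ℕ} (f : EuclideanSpace ℝ (Fin m) → ℝ)
    (x : EuclideanSpace ℝ (Fin m)) : ℝ :=
  ∑ i, pderivE i (pderivE i f) x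

open Topology in
/-- One-sided second derivative test. -/
theorem second_deriv_nonpos_of_right_max {f f' : ℝ → ℝ} {c : ℝ}
    (hf : ∀ᶠ t in 𝓝 (0 : ℝ), HasDerivAt f (f' t) t) (hf' : HasDerivAt f' c 0)
    (h0 : 0 ≤ f' 0) (hmax : ∀ᶠ t in 𝓝[>] (0 : ℝ), f t ≤ f 0) : c ≤ 0 := by
  by_contra! hc
  have hslope : ∀ᶠ t in 𝓝[>] (0 : ℝ), 0 < slope f' 0 t :=
    (hf'.tendsto_slope.mono_left (nhdsGT_le_nhdsNE 0)).eventually (lt_mem_nhds hc)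
  have hpos : ∀ᶠ t in 𝓝[>] (0 : ℝ), 0 < f' t := by
    filter_upwards [hslope, self_mem_nhdsWithin] with t ht (ht0 : 0 < t)
    rw [slope_def_field, sub_zero] at ht
    have := (div_pos_iff_of_pos_right ht0).1 ht
    linarith
  obtain ⟨ε, hε, hεs⟩ := Metric.eventually_nhds_iff.1 hf
  obtain ⟨δ, hδ, hδs⟩ := mem_nhdsGT_iff_exists_Ioo_subset.1 (hpos.and hmax)
  have hδ0 : (0 : ℝ) < δ := hδ
  set r := min ε δ / 2 with hr
  have hmin : 0 < min ε δ := lt_min hε hδ0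
  have hr0 : 0 < r := by positivity
  have hrε : r < ε := by have := min_le_left ε δ; linarith
  have hrδ : r < δ := by have := min_le_right ε δ; linarith
  have hd : ∀ t ∈ Set.Icc 0 r, HasDerivAt f (f' t) t := fun t ht => hεs (by
    rw [Real.dist_eq, sub_zero, abs_of_nonneg ht.1]; linarith [ht.2])
  have hmono : StrictMonoOn f (Set.Icc 0 r) := by
    refine strictMonoOn_of_deriv_pos (convex_Icc 0 r)
      (fun t ht => (hd t ht).continuousAt.continuousWithinAt) fun t ht => ?_
    rw [interior_Icc] at ht
    rw [(hd t (Set.Ioo_subset_Icc_self ht)).deriv]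
    exact (hδs ⟨ht.1, ht.2.trans hrδ⟩).1
  have h1 := hmono (Set.left_mem_Icc.2 hr0.le) (Set.right_mem_Icc.2 hr0.le) hr0
  have h2 : f r ≤ f 0 := (hδs (show r ∈ Set.Ioo 0 δ from ⟨hr0, hrδ⟩)).2
  linarith

theorem hasDerivAt_add_smul_single {m : ℕ} (i : Fin m) (x : EuclideanSpace ℝ (Fin m)) (t : ℝ) :
    HasDerivAt (fun t : ℝ => x + t • EuclideanSpace.single i (1 : ℝ))
      (EuclideanSpace.single i (1 : ℝ)) t := by
  simpa using ((hasDerivAt_id t).smul_const (EuclideanSpace.single i (1 : ℝ))).const_add x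

theorem norm_add_smul_single_sq {m : ℕ} (i : Fin m) (x : EuclideanSpace ℝ (Fin m)) (t : ℝ) :
    ‖x + t • EuclideanSpace.single i (1 : ℝ)‖ ^ 2 = ‖x‖ ^ 2 + 2 * t * x i + t ^ 2 := by
  rw [norm_add_sq_real, inner_smul_right, EuclideanSpace.inner_single_right, norm_smul]
  simp
  ring

open Topology in
theorem eventually_hasDerivAt_line {m : ℕ} {u : EuclideanSpace ℝ (Fin m) → ℝ}
    {x : EuclideanSpace ℝ (Fin m)} (hu : ContDiffAt ℝ 2 u x) (i : Fin m) :
    ∀ᶠ t in 𝓝 (0 : ℝ), HasDerivAt (fun t : ℝ => u (x + t • EuclideanSpace.single i (1 : ℝ)))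
      (pderivE i u (x + t • EuclideanSpace.single i (1 : ℝ))) t := by
  have hev : ∀ᶠ y in 𝓝 x, DifferentiableAt ℝ u y :=
    (hu.eventually (by simp)).mono fun y hy => hy.differentiableAt (by simp)
  have hcont : Tendsto (fun t : ℝ => x + t • EuclideanSpace.single i (1 : ℝ)) (𝓝 0) (𝓝 x) := by
    simpa using (hasDerivAt_add_smul_single i x 0).continuousAt.tendsto
  filter_upwards [hcont.eventually hev] with t ht
  exact ht.hasFDerivAt.comp_hasDerivAt t (hasDerivAt_add_smul_single i x t)

theorem hasDerivAt_pderivE_line {m : ℕ} {u : EuclideanSpace ℝ (Fin m) → ℝ}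
    {x : EuclideanSpace ℝ (Fin m)} (hu : ContDiffAt ℝ 2 u x) (i : Fin m) :
    HasDerivAt (fun t : ℝ => pderivE i u (x + t • EuclideanSpace.single i (1 : ℝ)))
      (pderivE i (pderivE i u) x) 0 := by
  have h1 : DifferentiableAt ℝ (fderiv ℝ u) x :=
    (hu.fderiv_right (m := 1) (by norm_num)).differentiableAt (by simp)
  have h2 : DifferentiableAt ℝ (pderivE i u) x :=
    h1.clm_apply (differentiableAt_const _)
  have h3 : HasFDerivAt (pderivE i u) (fderiv ℝ (pderivE i u) x)
      (x + (0 : ℝ) • EuclideanSpace.single i (1 : ℝ)) := by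
    simpa using h2.hasFDerivAt
  exact h3.comp_hasDerivAt 0 (hasDerivAt_add_smul_single i x 0)

/-- Derivative along a line of the radial barrier, a power of a quadratic polynomial. -/
theorem hasDerivAt_rpow_quadratic {s p q α M μ t : ℝ} (hpos : 0 < s - (p * t + q * t ^ 2)) :
    HasDerivAt (fun t : ℝ => μ + M * (s - (p * t + q * t ^ 2)) ^ (-α))
      (M * α * (p + 2 * q * t) * (s - (p * t + q * t ^ 2)) ^ (-α - 1)) t := by
  have h : HasDerivAt (fun t : ℝ => s - (p * t + q * t ^ 2)) (-(p + 2 * q * t)) t := by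
    have := (((hasDerivAt_id t).const_mul p).add
      (((hasDerivAt_id t).pow 2).const_mul q)).const_sub s
    refine this.congr_deriv ?_
    simp only [id, Nat.cast_ofNat]
    ring
  have := ((h.rpow_const (p := -α) (Or.inl hpos.ne')).const_mul M).const_add μ
  exact this.congr_deriv (by ring)

theorem hasDerivAt_deriv_rpow_quadratic {s p q α M : ℝ} (hs : 0 < s) :
    HasDerivAt (fun t : ℝ => M * α * (p + 2 * q * t) * (s - (p * t + q * t ^ 2)) ^ (-α - 1))
      (M * (α * (α + 1) * p ^ 2 * s ^ (-α - 2) + 2 * α * q * s ^ (-α - 1))) 0 := by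
  have h0 : 0 < s - (p * 0 + q * 0 ^ 2) := by simpa using hs
  have h1 : HasDerivAt (fun t : ℝ => M * α * (p + 2 * q * t)) (M * α * (2 * q)) 0 := by
    simpa using (((hasDerivAt_id (0 : ℝ)).const_mul (2 * q)).const_add p).const_mul (M * α)
  have h2 := hasDerivAt_rpow_quadratic (α := α + 1) (M := 1) (μ := 0) h0
  have h3 := h1.mul h2
  have e1 : -(α + 1) = -α - 1 := by ring
  have e2 : -α - 1 - 1 = -α - 2 := by ring
  simp only [e1, e2, zero_add, one_mul] at h3
  refine h3.congr_deriv ?_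
  ring_nf

open Topology in
/-- Laplacian comparison at a point of the closed halfspace where `u` is touched from above, over
the half ball of radius `R`, by the radial barrier `μ + M (1 - |y|² / R²)^(-α)`. -/
theorem laplacianE_le_of_touching {m : ℕ} (n : Fin m) {u : EuclideanSpace ℝ (Fin m) → ℝ}
    {x : EuclideanSpace ℝ (Fin m)} {M α R μ : ℝ} (hM : 0 ≤ M) (hα : 0 ≤ α) (hR : 0 < R)
    (hx : ‖x‖ < R) (hxn : 0 ≤ x n) (hu : ContDiffAt ℝ 2 u x)
    (hbdy : x n = 0 → 0 ≤ pderivE n u x)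
    (hmax : ∀ y : EuclideanSpace ℝ (Fin m), ‖y‖ < R → 0 ≤ y n →
      u y ≤ μ + M * (1 - ‖y‖ ^ 2 / R ^ 2) ^ (-α))
    (heq : u x = μ + M * (1 - ‖x‖ ^ 2 / R ^ 2) ^ (-α)) :
    laplacianE u x ≤
      M * ((4 * α * (α + 1) + 2 * m * α) / R ^ 2 * (1 - ‖x‖ ^ 2 / R ^ 2) ^ (-α - 2)) := by
  set s := 1 - ‖x‖ ^ 2 / R ^ 2 with hsdef
  have hs : 0 < s := by
    have : ‖x‖ ^ 2 / R ^ 2 < 1 := by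
      rw [div_lt_one (by positivity)]
      exact pow_lt_pow_left₀ hx (norm_nonneg x) two_ne_zero
    linarith
  have hs1 : s ≤ 1 := by
    have : 0 ≤ ‖x‖ ^ 2 / R ^ 2 := by positivity
    linarith
  have hdir : ∀ i : Fin m, pderivE i (pderivE i u) x ≤
      M * (α * (α + 1) * (2 * x i / R ^ 2) ^ 2 * s ^ (-α - 2) +
        2 * α * (1 / R ^ 2) * s ^ (-α - 1)) := by
    intro i
    set p := 2 * x i / R ^ 2 with hp
    set q := 1 / R ^ 2 with hq
    have hline : ∀ t : ℝ, 1 - ‖x + t • EuclideanSpace.single i (1 : ℝ)‖ ^ 2 / R ^ 2 =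
        s - (p * t + q * t ^ 2) := by
      intro t
      rw [norm_add_smul_single_sq, hsdef, hp, hq]
      field_simp
      ring
    have hcont : Continuous fun t : ℝ => x + t • EuclideanSpace.single i (1 : ℝ) := by fun_prop
    have hin : ∀ᶠ t in 𝓝 (0 : ℝ), ‖x + t • EuclideanSpace.single i (1 : ℝ)‖ < R :=
      (hcont.norm.tendsto 0).eventually (gt_mem_nhds (by simpa using hx))
    have hquad : ∀ᶠ t in 𝓝 (0 : ℝ), 0 < s - (p * t + q * t ^ 2) := by
      have : Continuous fun t : ℝ => s - (p * t + q * t ^ 2) := by fun_prop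
      exact (this.tendsto 0).eventually (lt_mem_nhds (by simpa using hs))
    set f : ℝ → ℝ := fun t => u (x + t • EuclideanSpace.single i (1 : ℝ)) -
      (μ + M * (s - (p * t + q * t ^ 2)) ^ (-α)) with hf
    set f' : ℝ → ℝ := fun t => pderivE i u (x + t • EuclideanSpace.single i (1 : ℝ)) -
      M * α * (p + 2 * q * t) * (s - (p * t + q * t ^ 2)) ^ (-α - 1) with hf'
    have hfd : ∀ᶠ t in 𝓝 (0 : ℝ), HasDerivAt f (f' t) t := by
      filter_upwards [eventually_hasDerivAt_line hu i, hquad] with t h1 h2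
      exact h1.sub (hasDerivAt_rpow_quadratic h2)
    have hfd' : HasDerivAt f' _ 0 :=
      (hasDerivAt_pderivE_line hu i).sub
        (hasDerivAt_deriv_rpow_quadratic (M := M) (α := α) (p := p) (q := q) hs)
    have hf0 : f 0 = 0 := by simp [hf, heq]
    have hle : ∀ᶠ t in 𝓝 (0 : ℝ),
        0 ≤ (x + t • EuclideanSpace.single i (1 : ℝ)) n → f t ≤ f 0 := by
      filter_upwards [hin] with t ht h
      have := hmax _ ht h
      rw [hline] at this
      rw [hf0]
      exact sub_nonpos.2 this
    have hcoord : ∀ t : ℝ, 0 ≤ t → 0 ≤ (x + t • EuclideanSpace.single i (1 : ℝ)) n := by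
      intro t ht
      by_cases h : n = i <;> simp [h] <;> [skip; exact hxn]
      rw [← h]; positivity
    have hright : ∀ᶠ t in 𝓝[>] (0 : ℝ), f t ≤ f 0 := by
      filter_upwards [nhdsWithin_le_nhds hle, self_mem_nhdsWithin] with t ht (ht0 : 0 < t)
      exact ht (hcoord t ht0.le)
    have hf'0 : 0 ≤ f' 0 := by
      by_cases hb : i = n ∧ x n = 0
      · obtain ⟨rfl, h0⟩ := hb
        simpa [hf', hp, h0] using hbdy h0
      · have hev : ∀ᶠ t in 𝓝 (0 : ℝ), 0 ≤ (x + t • EuclideanSpace.single i (1 : ℝ)) n := by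
          by_cases hin' : i = n
          · have hxpos : 0 < x n := lt_of_le_of_ne hxn fun h => hb ⟨hin', h.symm⟩
            have hc : Continuous fun t : ℝ => (x + t • EuclideanSpace.single i (1 : ℝ)) n := by
              fun_prop
            exact ((hc.tendsto 0).eventually (lt_mem_nhds (by simpa using hxpos))).mono
              fun t ht => le_of_lt ht
          · exact Eventually.of_forall fun t => by simp [Ne.symm hin', hxn]
        have hlm : IsLocalMax f 0 := by
          filter_upwards [hle, hev] with t h1 h2 using h1 h2
        exact (hlm.hasDerivAt_eq_zero hfd.self_of_nhds).ge
    have := second_deriv_nonpos_of_right_max hfd hfd' hf'0 hright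
    linarith
  have hsum : ∑ i, (x i) ^ 2 = ‖x‖ ^ 2 := by
    rw [EuclideanSpace.norm_sq_eq]; simp
  have hpow : s ^ (-α - 1) ≤ s ^ (-α - 2) :=
    Real.rpow_le_rpow_of_exponent_ge hs hs1 (by linarith)
  have hxR : ‖x‖ ^ 2 / R ^ 2 ≤ 1 := by linarith
  have hP : 0 < s ^ (-α - 2) := Real.rpow_pos_of_pos hs _
  calc laplacianE u x ≤ ∑ i : Fin m, M * (α * (α + 1) * (2 * x i / R ^ 2) ^ 2 * s ^ (-α - 2) +
        2 * α * (1 / R ^ 2) * s ^ (-α - 1)) := Finset.sum_le_sum fun i _ => hdir i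
    _ = M * (4 * α * (α + 1) / R ^ 2 * (‖x‖ ^ 2 / R ^ 2) * s ^ (-α - 2) +
        2 * m * α / R ^ 2 * s ^ (-α - 1)) := by
      rw [← Finset.mul_sum, Finset.sum_add_distrib, ← hsum, Finset.sum_const, Finset.card_univ,
        Fintype.card_fin, nsmul_eq_mul, Finset.sum_div, Finset.mul_sum, Finset.sum_mul]
      congr 2
      · refine Finset.sum_congr rfl fun i _ => ?_
        field_simp
        ring
      · ring
    _ ≤ M * (4 * α * (α + 1) / R ^ 2 * 1 * s ^ (-α - 2) +
        2 * m * α / R ^ 2 * s ^ (-α - 2)) := by gcongr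
    _ = _ := by ring

/-- Keller–Osserman bound on a half ball: a subsolution of `Δu = β u^σ` above the level `μ` exceeds
`μ`, after weighting by `(1 - |x|² / R²)^(2/(σ-1))`, by at most `M` with
`β M^(σ-1) ≤ C / R²`. -/
theorem keller_osserman_halfBall {m : ℕ} (n : Fin m) {u : EuclideanSpace ℝ (Fin m) → ℝ}
    {σ α β R μ d : ℝ} (hσ : 1 < σ) (hα : α = 2 / (σ - 1)) (hβ : 0 ≤ β) (hR : 0 < R)
    (hμ : 0 ≤ μ) (hd : 0 < d)
    (hu : ∀ x : EuclideanSpace ℝ (Fin m), 0 ≤ x n → ContDiffAt ℝ 2 u x)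
    (hbdy : ∀ x : EuclideanSpace ℝ (Fin m), x n = 0 → 0 ≤ pderivE n u x)
    (hineq : ∀ x : EuclideanSpace ℝ (Fin m), ‖x‖ ≤ R → 0 ≤ x n → μ < u x →
      β * u x ^ σ ≤ laplacianE u x)
    {z : EuclideanSpace ℝ (Fin m)} (hzR : ‖z‖ ≤ R) (hzn : 0 ≤ z n)
    (hz : d ≤ (u z - μ) * (1 - ‖z‖ ^ 2 / R ^ 2) ^ α) :
    β * d ^ (σ - 1) ≤ (4 * α * (α + 1) + 2 * m * α) / R ^ 2 := by
  have hσ1 : 0 < σ - 1 := by linarith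
  have hα0 : 0 < α := by rw [hα]; positivity
  have hασ : -α * σ = -α - 2 := by
    have : α * (σ - 1) = 2 := by rw [hα]; field_simp
    linarith
  set S : Set (EuclideanSpace ℝ (Fin m)) := Metric.closedBall 0 R ∩ {x | 0 ≤ x n} with hS
  have hScomp : IsCompact S := (isCompact_closedBall 0 R).inter_right
    (isClosed_le continuous_const (by fun_prop))
  have hF : ContinuousOn (fun y => (u y - μ) * (1 - ‖y‖ ^ 2 / R ^ 2) ^ α) S := by
    refine ContinuousOn.mul ?_ ?_
    · exact ContinuousOn.sub (fun y hy => (hu y hy.2).continuousAt.continuousWithinAt)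
        continuousOn_const
    · exact ContinuousOn.rpow_const (by fun_prop) fun y _ => Or.inr hα0.le
  obtain ⟨x, hxS, hxmax⟩ := hScomp.exists_isMaxOn ⟨z, by simpa [hS] using ⟨hzR, hzn⟩⟩ hF
  set M := (u x - μ) * (1 - ‖x‖ ^ 2 / R ^ 2) ^ α with hMdef
  have hdM : d ≤ M := hz.trans (hxmax (show z ∈ S by simpa [hS] using ⟨hzR, hzn⟩))
  have hM : 0 < M := hd.trans_le hdM
  have hxR : ‖x‖ < R := by
    refine lt_of_le_of_ne (by simpa using hxS.1) fun h => hM.ne' ?_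
    rw [hMdef, h, div_self (by positivity), sub_self, Real.zero_rpow hα0.ne', mul_zero]
  have hpos : ∀ y : EuclideanSpace ℝ (Fin m), ‖y‖ < R → 0 < 1 - ‖y‖ ^ 2 / R ^ 2 := by
    intro y hy
    rw [sub_pos, div_lt_one (by positivity)]
    exact pow_lt_pow_left₀ hy (norm_nonneg y) two_ne_zero
  have hmax : ∀ y : EuclideanSpace ℝ (Fin m), ‖y‖ < R → 0 ≤ y n →
      u y ≤ μ + M * (1 - ‖y‖ ^ 2 / R ^ 2) ^ (-α) := by
    intro y hy hyn
    have h1 : (u y - μ) * (1 - ‖y‖ ^ 2 / R ^ 2) ^ α ≤ M :=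
      hxmax (show y ∈ S by simpa [hS] using ⟨hy.le, hyn⟩)
    rw [Real.rpow_neg (hpos y hy).le, ← div_eq_mul_inv, ← sub_le_iff_le_add']
    exact (le_div_iff₀ (Real.rpow_pos_of_pos (hpos y hy) _)).2 h1
  set s := 1 - ‖x‖ ^ 2 / R ^ 2 with hsdef
  have hs : 0 < s := hpos x hxR
  have heq : u x = μ + M * s ^ (-α) := by
    rw [hMdef, mul_assoc, ← Real.rpow_add hs]
    simp
  have hP : 0 < s ^ (-α - 2) := Real.rpow_pos_of_pos hs _
  have hsα : 0 < s ^ (-α) := Real.rpow_pos_of_pos hs _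
  have hgt : M * s ^ (-α) ≤ u x := by linarith
  have hup := laplacianE_le_of_touching n hM.le hα0.le hR hxR hxS.2 (hu x hxS.2) (hbdy x) hmax heq
  have hlow := hineq x hxR.le hxS.2 (by have := mul_pos hM hsα; linarith)
  have hpow : (M * s ^ (-α)) ^ σ = M * M ^ (σ - 1) * s ^ (-α - 2) := by
    rw [Real.mul_rpow hM.le hsα.le, ← Real.rpow_mul hs.le, hασ]
    congr 1
    rw [mul_comm, ← Real.rpow_add_one hM.ne']
    congr 1; ring
  have h1 : β * (M * d ^ (σ - 1) * s ^ (-α - 2)) ≤ β * u x ^ σ := by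
    refine mul_le_mul_of_nonneg_left ?_ hβ
    calc M * d ^ (σ - 1) * s ^ (-α - 2) ≤ M * M ^ (σ - 1) * s ^ (-α - 2) := by gcongr
      _ = (M * s ^ (-α)) ^ σ := hpow.symm
      _ ≤ u x ^ σ := Real.rpow_le_rpow (by positivity) hgt (by linarith)
  rw [← hsdef] at hup
  have h2 := (h1.trans hlow).trans hup
  refine le_of_mul_le_mul_right ?_ (mul_pos hM hP)
  linarith

theorem exists_pos_le_of_isCompact_inter {X : Type*} [TopologicalSpace X] {K H : Set X}
    {b : X → ℝ} (hK : IsCompact K) (hH : IsClosed H) (hb : ContinuousOn b H)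
    (hpos : ∀ x ∈ H, 0 < b x) : ∃ c > 0, ∀ x ∈ K ∩ H, c ≤ b x := by
  rcases (K ∩ H).eq_empty_or_nonempty with h | h
  · exact ⟨1, one_pos, by simp [h]⟩
  · obtain ⟨y, hy, hmin⟩ := (hK.inter_right hH).exists_isMinOn h (hb.mono Set.inter_subset_right)
    exact ⟨b y, hpos y hy.2, fun x hx => hmin hx⟩

/-- Absorption of the linear term above a level `μ` with `H₀ < μ^(σ-1)`. -/
theorem rpow_le_of_negPart_div_le {a b v H₀ μ σ : ℝ} (hb : 0 < b) (hH₀ : 0 ≤ H₀)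
    (hab : max (-a) 0 / b ≤ H₀) (hσ : 1 < σ) (hμ : 0 < μ) (hv : μ ≤ v) :
    (1 - H₀ / μ ^ (σ - 1)) * b * v ^ σ ≤ b * v ^ σ + a * v := by
  have hv0 : 0 < v := hμ.trans_le hv
  have ha : -a ≤ H₀ * b := (le_max_left _ _).trans ((div_le_iff₀ hb).1 hab)
  have hpow : v ^ σ = v ^ (σ - 1) * v := by
    rw [← Real.rpow_add_one hv0.ne']; congr 1; ring
  have hT : 0 < μ ^ (σ - 1) := Real.rpow_pos_of_pos hμ _
  have hmon : μ ^ (σ - 1) ≤ v ^ (σ - 1) := Real.rpow_le_rpow hμ.le hv (by linarith)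
  have h1 : H₀ * b ≤ H₀ / μ ^ (σ - 1) * b * v ^ (σ - 1) := by
    have : H₀ ≤ H₀ / μ ^ (σ - 1) * v ^ (σ - 1) := by
      rw [div_mul_eq_mul_div, le_div_iff₀ hT]
      exact mul_le_mul_of_nonneg_left hmon hH₀
    calc H₀ * b ≤ (H₀ / μ ^ (σ - 1) * v ^ (σ - 1)) * b := by gcongr
      _ = _ := by ring
  have h2 := mul_le_mul_of_nonneg_right (ha.trans h1) hv0.le
  rw [hpow]
  linarith

/-- Instance on the closed upper halfspace `H = {x ∈ ℝ^m : x_m ≥ 0}`, with classical `C²`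
regularity, of the a priori estimate of **Corollary 3.9** of the paper.  `Q : [0,∞) → (0,∞)`
is nondecreasing with `Q(t) = o(t²)` and `liminf Q(t)·log t/t² < ∞`; `a`, `b` are continuous
on `H`, with negative part `a₋ = max (-a) 0` bounded on `H`, `b > 0` with `b(x) ≥ 1/Q(|x|)`
outside a compact set and `a₋/b ≤ H₀` on `H` for some `H₀ > 0`; `σ > 1`; `u ≥ 0` is `C²` near
`H` with `∂u/∂x_m ≥ 0` on `∂H`, and satisfies `Δu ≥ b·u^σ + a·u` on the nonempty superlevel
set `Ω_γ = {x ∈ H : u(x) > γ}` (i.e. `γ < sup_H u ≤ +∞`).  Then `u ≤ H₀^(1/(σ-1))` on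
`Ω_γ`. -/
theorem halfspace_apriori_estimate (m : ℕ) (hm : 2 ≤ m)
    (Q : ℝ → ℝ) (hQpos : ∀ t : ℝ, 0 ≤ t → 0 < Q t) (hQmono : MonotoneOn Q (Set.Ici 0))
    (hlittleo : (fun t => Q t) =o[atTop] fun t => t ^ 2)
    (hliminf : ∃ C : ℝ, ∃ᶠ t in atTop, Q t * Real.log t / t ^ 2 ≤ C)
    (a b : EuclideanSpace ℝ (Fin m) → ℝ)
    (hac : ContinuousOn a {x : EuclideanSpace ℝ (Fin m) | 0 ≤ x ⟨m - 1, by omega⟩})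
    (hbc : ContinuousOn b {x : EuclideanSpace ℝ (Fin m) | 0 ≤ x ⟨m - 1, by omega⟩})
    (haminus : BddAbove ((fun x => max (-(a x)) 0) ''
      {x : EuclideanSpace ℝ (Fin m) | 0 ≤ x ⟨m - 1, by omega⟩}))
    (hbpos : ∀ x : EuclideanSpace ℝ (Fin m), 0 ≤ x ⟨m - 1, by omega⟩ → 0 < b x)
    (K : Set (EuclideanSpace ℝ (Fin m))) (hK : IsCompact K)
    (hbQ : ∀ x : EuclideanSpace ℝ (Fin m), 0 ≤ x ⟨m - 1, by omega⟩ → x ∉ K →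
      1 / Q ‖x‖ ≤ b x)
    (H₀ : ℝ) (hH₀ : 0 < H₀)
    (hab : ∀ x : EuclideanSpace ℝ (Fin m), 0 ≤ x ⟨m - 1, by omega⟩ →
      max (-(a x)) 0 / b x ≤ H₀)
    (σ : ℝ) (hσ : 1 < σ)
    (u : EuclideanSpace ℝ (Fin m) → ℝ)
    (hupos : ∀ x : EuclideanSpace ℝ (Fin m), 0 ≤ x ⟨m - 1, by omega⟩ → 0 ≤ u x)
    (hu : ∀ x : EuclideanSpace ℝ (Fin m), 0 ≤ x ⟨m - 1, by omega⟩ → ContDiffAt ℝ 2 u x)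
    (hbdy : ∀ x : EuclideanSpace ℝ (Fin m), x ⟨m - 1, by omega⟩ = 0 →
      0 ≤ pderivE (⟨m - 1, by omega⟩ : Fin m) u x)
    (γ : ℝ)
    (hγ : ∃ x : EuclideanSpace ℝ (Fin m), 0 ≤ x ⟨m - 1, by omega⟩ ∧ γ < u x)
    (hineq : ∀ x : EuclideanSpace ℝ (Fin m), 0 ≤ x ⟨m - 1, by omega⟩ → γ < u x →
      b x * u x ^ σ + a x * u x ≤ laplacianE u x) :
    ∀ x : EuclideanSpace ℝ (Fin m), 0 ≤ x ⟨m - 1, by omega⟩ → γ < u x →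
      u x ≤ H₀ ^ (1 / (σ - 1)) := by
  intro z hzn hzγ
  by_contra! hlt
  set n : Fin m := ⟨m - 1, by omega⟩ with hn
  have hσ1 : 0 < σ - 1 := by linarith
  obtain ⟨μ, hμ1, hμz⟩ := exists_between (max_lt hzγ hlt)
  have hγμ : γ < μ := (le_max_left _ _).trans_lt hμ1
  have hHμ : H₀ ^ (1 / (σ - 1)) < μ := (le_max_right _ _).trans_lt hμ1
  have hμ : 0 < μ := (Real.rpow_pos_of_pos hH₀ _).trans hHμ
  have hHT : H₀ < μ ^ (σ - 1) := by
    have := Real.rpow_lt_rpow (Real.rpow_nonneg hH₀.le _) hHμ hσ1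
    rwa [← Real.rpow_mul hH₀.le, one_div_mul_cancel hσ1.ne', Real.rpow_one] at this
  set k := 1 - H₀ / μ ^ (σ - 1) with hk
  have hk0 : 0 < k := by
    rw [hk, sub_pos, div_lt_one (Real.rpow_pos_of_pos hμ _)]
    exact hHT
  obtain ⟨b₀, hb₀, hbK⟩ := exists_pos_le_of_isCompact_inter hK
    (isClosed_le continuous_const (by fun_prop)) hbc hbpos
  have hQ0 := hQpos 0 le_rfl
  set c := min 1 (b₀ * Q 0) with hc
  have hc0 : 0 < c := lt_min one_pos (by positivity)
  have hbR : ∀ R : ℝ, ∀ x : EuclideanSpace ℝ (Fin m), ‖x‖ ≤ R → 0 ≤ x n → c / Q R ≤ b x := by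
    intro R x hxR hxn
    have hR0 : 0 ≤ R := (norm_nonneg x).trans hxR
    have hQR := hQpos R hR0
    by_cases hxK : x ∈ K
    · refine le_trans ?_ (hbK x ⟨hxK, hxn⟩)
      rw [div_le_iff₀ hQR]
      exact (min_le_right _ _).trans
        (mul_le_mul_of_nonneg_left (hQmono Set.self_mem_Ici hR0 hR0) hb₀.le)
    · refine le_trans ?_ (hbQ x hxn hxK)
      have := hQpos ‖x‖ (norm_nonneg x)
      exact div_le_div₀ zero_le_one (min_le_left _ _) this (hQmono (norm_nonneg x) hR0 hxR)
  set α := 2 / (σ - 1) with hα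
  have hα0 : 0 < α := by positivity
  set C := 4 * α * (α + 1) + 2 * m * α with hC
  have hC0 : 0 < C := by positivity
  set d := (u z - μ) * (1 / 2 : ℝ) ^ α with hd
  have hd0 : 0 < d := mul_pos (by linarith) (Real.rpow_pos_of_pos (by norm_num) _)
  have hdσ : 0 < d ^ (σ - 1) := Real.rpow_pos_of_pos hd0 _
  set ε := k * c * d ^ (σ - 1) / (2 * C) with hε
  have hε0 : 0 < ε := by positivity
  obtain ⟨R, hQR, hRz⟩ :=
    ((hlittleo.def hε0).and (eventually_ge_atTop (2 * ‖z‖ + 1))).exists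
  have hz0 := norm_nonneg z
  have hR : 0 < R := by linarith
  have hQRpos := hQpos R hR.le
  rw [Real.norm_of_nonneg hQRpos.le, Real.norm_of_nonneg (by positivity)] at hQR
  have hzs : (1 / 2 : ℝ) ≤ 1 - ‖z‖ ^ 2 / R ^ 2 := by
    have : ‖z‖ ^ 2 / R ^ 2 ≤ 1 / 2 := by
      rw [div_le_iff₀ (by positivity)]
      nlinarith
    linarith
  have hKO := keller_osserman_halfBall n (u := u) (β := k * (c / Q R)) (R := R) (μ := μ) (d := d)
    hσ hα (by positivity) hR hμ.le hd0 hu hbdy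
    (fun x hxR hxn hxμ => by
      have hux := hμ.trans hxμ
      have h1 := rpow_le_of_negPart_div_le (hbpos x hxn) hH₀.le (hab x hxn) hσ hμ hxμ.le
      have h2 := hineq x hxn (hγμ.trans hxμ)
      refine le_trans ?_ (h1.trans h2)
      have h3 := hbR R x hxR hxn
      have h4 := Real.rpow_nonneg hux.le σ
      gcongr)
    (z := z) (by linarith) hzn
    (mul_le_mul_of_nonneg_left
      (Real.rpow_le_rpow (by norm_num) hzs hα0.le) (by linarith))
  rw [← hC, le_div_iff₀ (by positivity)] at hKO
  have h1 : k * c * d ^ (σ - 1) * R ^ 2 ≤ C * Q R := by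
    have := mul_le_mul_of_nonneg_right hKO hQRpos.le
    have e : k * (c / Q R) * d ^ (σ - 1) * R ^ 2 * Q R = k * c * d ^ (σ - 1) * R ^ 2 := by
      field_simp
    linarith
  have h2 : C * Q R ≤ k * c * d ^ (σ - 1) * R ^ 2 / 2 := by
    calc C * Q R ≤ C * (ε * R ^ 2) := by gcongr
      _ = _ := by rw [hε]; field_simp
  have h3 : 0 < k * c * d ^ (σ - 1) * R ^ 2 := by positivity
  linarith
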